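/- (Lemma 5.1, supersolution) Let μ ∈ (0,2), let V_μ = {(r cos θ, r sin θ) : 0 < r < ∞, 0 < θ < μπ} ⊂ ℝ², let v_μ(r,θ) = −log( μ r sin(θ/μ) ), and let A > 0. Then the function ū_μ(z) = v_μ(z) + log( 1 + A |z|^{√2/μ} ) satisfies Δū_μ ≤ e^{2ū_μ} everywhere in V_μ. -/

import Mathlib

/-- The Laplacian of a function on `ℂ ≅ ℝ²`: sum of the second directional
derivatives in the two coordinate directions `1` and `I`. -/
noncomputable def lap (u : ℂ → ℝ) (z : ℂ) : ℝ :=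
  fderiv ℝ (fun w => fderiv ℝ u w 1) z 1 +
  fderiv ℝ (fun w => fderiv ℝ u w Complex.I) z Complex.I

/-- The polar angle of a nonzero complex number, normalized to lie in `(0, 2π]`. -/
noncomputable def polarAngle (z : ℂ) : ℝ :=
  if 0 < Complex.arg z then Complex.arg z else Complex.arg z + 2 * Real.pi

/-- The open infinite cone `V_μ = {(r cos θ, r sin θ) : 0 < r, 0 < θ < μπ}` in `ℂ ≅ ℝ²`. -/
def cone (μ : ℝ) : Set ℂ :=
  {z | ∃ r θ : ℝ, 0 < r ∧ 0 < θ ∧ θ < μ * Real.pi ∧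
    z = (r : ℂ) * Complex.exp ((θ : ℂ) * Complex.I)}

theorem polarAngle_eq_arg_neg_add_pi {z : ℂ} (hz : -z ∈ Complex.slitPlane) :
    polarAngle z = Complex.arg (-z) + Real.pi := by
  unfold polarAngle
  by_cases him : z.im < 0
  · have h := (Complex.arg_neg_eq_arg_add_pi_iff).2 (Or.inl him)
    have hneg : Complex.arg z < 0 := Complex.arg_neg_iff.2 him
    rw [if_neg (not_lt.2 hneg.le), h]
    ring
  · have hcase : 0 < z.im ∨ z.im = 0 ∧ z.re < 0 := by
      rcases (not_lt.1 him).lt_or_eq with h | h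
      · exact Or.inl h
      · refine Or.inr ⟨h.symm, ?_⟩
        rcases hz with h' | h'
        · simpa using h'
        · exact absurd h.symm (by simpa using h')
    have h := (Complex.arg_neg_eq_arg_sub_pi_iff).2 hcase
    have hpos : 0 < Complex.arg z := by
      have := Complex.neg_pi_lt_arg (-z)
      linarith
    rw [if_pos hpos, h]
    ring

theorem neg_mem_slitPlane_and_arg_of_mem_cone {μ : ℝ} (hμ2 : μ < 2) {z : ℂ} (hz : z ∈ cone μ) :
    -z ∈ Complex.slitPlane ∧ 0 < Complex.arg (-z) + Real.pi ∧
      Complex.arg (-z) + Real.pi < μ * Real.pi := by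
  obtain ⟨r, θ, hr, hθ0, hθ, rfl⟩ := hz
  have hlt : θ < 2 * Real.pi := hθ.trans (by gcongr)
  have hneg : -((r : ℂ) * Complex.exp ((θ : ℂ) * Complex.I)) =
      (r : ℂ) * Complex.exp (((θ - Real.pi : ℝ) : ℂ) * Complex.I) := by
    push_cast
    rw [sub_mul, Complex.exp_sub, Complex.exp_pi_mul_I]
    ring
  have harg : Complex.arg (-((r : ℂ) * Complex.exp ((θ : ℂ) * Complex.I))) = θ - Real.pi := by
    rw [hneg, Complex.exp_mul_I]
    exact Complex.arg_mul_cos_add_sin_mul_I hr ⟨by linarith, by linarith⟩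
  refine ⟨Complex.mem_slitPlane_iff_arg.2 ⟨?_, ?_⟩, ?_, ?_⟩
  · rw [harg]; intro h; linarith
  · simp [hr.ne']
  · rw [harg]; linarith
  · rw [harg]; linarith

theorem hasFDerivAt_log_neg {z : ℂ} (hz : -z ∈ Complex.slitPlane) :
    HasFDerivAt (fun x : ℂ => Complex.log (-x)) (z⁻¹ • (1 : ℂ →L[ℝ] ℂ)) z := by
  have h : HasDerivAt (fun x : ℂ => Complex.log (-x)) (-1 / -z) z := (hasDerivAt_neg z).clog hz
  rw [neg_div_neg_eq, one_div] at h
  exact h.complexToReal_fderiv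

/-- Derivative of a sum of functions of the real and imaginary parts of `log (-z)`. -/
theorem hasFDerivAt_comp_log_neg {F G : ℝ → ℝ} {F' G' : ℝ} {z : ℂ}
    (hz : -z ∈ Complex.slitPlane)
    (hF : HasDerivAt F F' (Complex.log (-z)).re) (hG : HasDerivAt G G' (Complex.log (-z)).im) :
    HasFDerivAt (fun x : ℂ => F (Complex.log (-x)).re + G (Complex.log (-x)).im)
      (F' • Complex.reCLM.comp (z⁻¹ • (1 : ℂ →L[ℝ] ℂ)) +
        G' • Complex.imCLM.comp (z⁻¹ • (1 : ℂ →L[ℝ] ℂ))) z := by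
  have hL := hasFDerivAt_log_neg hz
  have hre : HasFDerivAt (fun x : ℂ => (Complex.log (-x)).re)
      (Complex.reCLM.comp (z⁻¹ • (1 : ℂ →L[ℝ] ℂ))) z := Complex.reCLM.hasFDerivAt.comp z hL
  have him : HasFDerivAt (fun x : ℂ => (Complex.log (-x)).im)
      (Complex.imCLM.comp (z⁻¹ • (1 : ℂ →L[ℝ] ℂ))) z := Complex.imCLM.hasFDerivAt.comp z hL
  exact (hF.comp_hasFDerivAt z hre).add (hG.comp_hasFDerivAt z him)

theorem continuousAt_log_neg {z : ℂ} (hz : -z ∈ Complex.slitPlane) :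
    ContinuousAt (fun x : ℂ => Complex.log (-x)) z :=
  (hasFDerivAt_log_neg hz).continuousAt

theorem eventually_neg_mem_slitPlane {z : ℂ} (hz : -z ∈ Complex.slitPlane) :
    ∀ᶠ x in nhds z, -x ∈ Complex.slitPlane :=
  continuous_neg.continuousAt.eventually (Complex.isOpen_slitPlane.mem_nhds hz)

theorem fderiv_fderiv_comp_log_neg {u : ℂ → ℝ} {F G F' G' : ℝ → ℝ} {F'' G'' : ℝ} {z : ℂ}
    (hz : -z ∈ Complex.slitPlane)
    (hu : u =ᶠ[nhds z] fun x => F (Complex.log (-x)).re + G (Complex.log (-x)).im)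
    (hF : ∀ᶠ t in nhds (Complex.log (-z)).re, HasDerivAt F (F' t) t)
    (hG : ∀ᶠ t in nhds (Complex.log (-z)).im, HasDerivAt G (G' t) t)
    (hF' : HasDerivAt F' F'' (Complex.log (-z)).re)
    (hG' : HasDerivAt G' G'' (Complex.log (-z)).im) (h : ℂ) :
    fderiv ℝ (fun x => fderiv ℝ u x h) z h =
      F'' * (z⁻¹ * h).re ^ 2 - F' (Complex.log (-z)).re * ((z⁻¹ * h) ^ 2).re +
      (G'' * (z⁻¹ * h).im ^ 2 - G' (Complex.log (-z)).im * ((z⁻¹ * h) ^ 2).im) := by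
  have hz0 : z ≠ 0 := by
    rintro rfl
    simp at hz
  have hre : ContinuousAt (fun x : ℂ => (Complex.log (-x)).re) z :=
    Complex.continuous_re.continuousAt.comp (continuousAt_log_neg hz)
  have him : ContinuousAt (fun x : ℂ => (Complex.log (-x)).im) z :=
    Complex.continuous_im.continuousAt.comp (continuousAt_log_neg hz)
  have hfirst : (fun x => fderiv ℝ u x h) =ᶠ[nhds z] fun x =>
      F' (Complex.log (-x)).re * (x⁻¹ * h).re + G' (Complex.log (-x)).im * (x⁻¹ * h).im := by
    filter_upwards [hu.eventuallyEq_nhds, hre.eventually hF, him.eventually hG,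
      eventually_neg_mem_slitPlane hz] with x hux hFx hGx hx
    rw [hux.fderiv_eq, (hasFDerivAt_comp_log_neg hx hFx hGx).fderiv]
    simp
  have hinv : HasFDerivAt (fun x : ℂ => x⁻¹ * h) ((-(z ^ 2)⁻¹ * h) • (1 : ℂ →L[ℝ] ℂ)) z :=
    ((hasDerivAt_inv hz0).mul_const h).complexToReal_fderiv
  have hL := hasFDerivAt_log_neg hz
  have h1 := (hF'.comp_hasFDerivAt z (Complex.reCLM.hasFDerivAt.comp z hL)).mul
    (Complex.reCLM.hasFDerivAt.comp z hinv)
  have h2 := (hG'.comp_hasFDerivAt z (Complex.imCLM.hasFDerivAt.comp z hL)).mul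
    (Complex.imCLM.hasFDerivAt.comp z hinv)
  have hsq : -(z ^ 2)⁻¹ * h * h = -(z⁻¹ * h) ^ 2 := by
    rw [mul_pow, inv_pow]; ring
  rw [hfirst.fderiv_eq]
  refine (congrArg (fun T : ℂ →L[ℝ] ℝ => T h) (h1.add h2).fderiv).trans ?_
  simp only [Function.comp_apply, add_apply, smul_apply,
    ContinuousLinearMap.comp_apply, one_apply_eq_self, Complex.reCLM_apply,
    Complex.imCLM_apply, smul_eq_mul, hsq, Complex.neg_re, Complex.neg_im]
  ring

/-- In logarithmic coordinates the Laplacian is `|z|⁻²` times the flat Laplacian. -/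
theorem lap_comp_log_neg {u : ℂ → ℝ} {F G F' G' : ℝ → ℝ} {F'' G'' : ℝ} {z : ℂ}
    (hz : -z ∈ Complex.slitPlane)
    (hu : u =ᶠ[nhds z] fun x => F (Complex.log (-x)).re + G (Complex.log (-x)).im)
    (hF : ∀ᶠ t in nhds (Complex.log (-z)).re, HasDerivAt F (F' t) t)
    (hG : ∀ᶠ t in nhds (Complex.log (-z)).im, HasDerivAt G (G' t) t)
    (hF' : HasDerivAt F' F'' (Complex.log (-z)).re)
    (hG' : HasDerivAt G' G'' (Complex.log (-z)).im) :
    lap u z = (F'' + G'') / ‖z‖ ^ 2 := by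
  have hn : (z⁻¹).re ^ 2 + (z⁻¹).im ^ 2 = (‖z‖ ^ 2)⁻¹ := by
    rw [← inv_pow, ← norm_inv, ← Complex.normSq_eq_norm_sq, Complex.normSq_apply]
    ring
  unfold lap
  rw [fderiv_fderiv_comp_log_neg hz hu hF hG hF' hG' 1,
    fderiv_fderiv_comp_log_neg hz hu hF hG hF' hG' Complex.I, div_eq_mul_inv, ← hn]
  simp [pow_two]
  ring

theorem hasDerivAt_neg_add_log_one_add_exp {A : ℝ} (hA : 0 < A) (a c t : ℝ) :
    HasDerivAt (fun t => -(c + t) + Real.log (1 + A * Real.exp (a * t)))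
      (-1 + A * (Real.exp (a * t) * a) / (1 + A * Real.exp (a * t))) t := by
  have hpos : 0 < 1 + A * Real.exp (a * t) := by positivity
  have he : HasDerivAt (fun t => Real.exp (a * t)) (Real.exp (a * t) * a) t := by
    simpa using ((hasDerivAt_id t).const_mul a).exp
  exact ((hasDerivAt_id t).const_add c).neg.add (((he.const_mul A).const_add 1).log hpos.ne')

theorem hasDerivAt_neg_one_add_logistic {A : ℝ} (hA : 0 < A) (a t : ℝ) :
    HasDerivAt (fun t => -1 + A * (Real.exp (a * t) * a) / (1 + A * Real.exp (a * t)))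
      (a ^ 2 * (A * Real.exp (a * t)) / (1 + A * Real.exp (a * t)) ^ 2) t := by
  have hpos : 0 < 1 + A * Real.exp (a * t) := by positivity
  have he : HasDerivAt (fun t => Real.exp (a * t)) (Real.exp (a * t) * a) t := by
    simpa using ((hasDerivAt_id t).const_mul a).exp
  refine ((((he.mul_const a).const_mul A).div ((he.const_mul A).const_add 1) hpos.ne').const_add
    (-1)).congr_deriv ?_
  ring

theorem hasDerivAt_neg_log_sin_div {μ c t : ℝ} (ht : Real.sin ((t + c) / μ) ≠ 0) :
    HasDerivAt (fun t => -Real.log (Real.sin ((t + c) / μ)))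
      (-(Real.cos ((t + c) / μ) * (1 / μ) / Real.sin ((t + c) / μ))) t :=
  (((((hasDerivAt_id t).add_const c).div_const μ).sin).log ht).neg

theorem hasDerivAt_neg_cot_div {μ c t : ℝ} (ht : Real.sin ((t + c) / μ) ≠ 0) :
    HasDerivAt (fun t => -(Real.cos ((t + c) / μ) * (1 / μ) / Real.sin ((t + c) / μ)))
      (1 / (μ ^ 2 * Real.sin ((t + c) / μ) ^ 2)) t := by
  have hlin : HasDerivAt (fun t => (t + c) / μ) (1 / μ) t :=
    ((hasDerivAt_id t).add_const c).div_const μ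
  refine ((hlin.cos.mul_const (1 / μ)).div hlin.sin ht).neg.congr_deriv ?_
  rcases eq_or_ne μ 0 with rfl | hμ
  · simp
  · field_simp
    linear_combination Real.sin_sq_add_cos_sq ((t + c) / μ)

theorem liouville_algebraic_inequality {s T : ℝ} (hs : 0 < s) (hs1 : s ≤ 1) (hT : 0 < T) :
    2 * T / (1 + T) ^ 2 + 1 / s ^ 2 ≤ (1 + T) ^ 2 / s ^ 2 := by
  have h1 : 2 * T / (1 + T) ^ 2 ≤ 2 * T :=
    div_le_self (by positivity) (one_le_pow₀ (by linarith))
  have h2 : 2 * T ≤ 2 * T / s ^ 2 :=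
    le_div_self (by positivity) (by positivity) (pow_le_one₀ hs.le hs1)
  have h3 : (1 + T) ^ 2 / s ^ 2 = 1 / s ^ 2 + 2 * T / s ^ 2 + T ^ 2 / s ^ 2 := by ring
  have h4 : 0 ≤ T ^ 2 / s ^ 2 := by positivity
  linarith

/-- Lemma 5.1, supersolution: `v_μ + log(1 + A|z|^{√2/μ})` is a
supersolution of Liouville's equation in the cone `V_μ`. -/
theorem liouville_cone_supersolution (μ : ℝ) (hμ0 : 0 < μ) (hμ2 : μ < 2)
    (A : ℝ) (hA : 0 < A) (w : ℂ → ℝ)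
    (hw : ∀ z : ℂ, w z = -Real.log (μ * ‖z‖ * Real.sin (polarAngle z / μ))
      + Real.log (1 + A * ‖z‖ ^ (Real.sqrt 2 / μ))) :
    ∀ z ∈ cone μ, lap w z ≤ Real.exp (2 * w z) := by
  intro z hz
  obtain ⟨hslit, harg0, harg1⟩ := neg_mem_slitPlane_and_arg_of_mem_cone hμ2 hz
  set a : ℝ := Real.sqrt 2 / μ with ha
  have hsin : 0 < Real.sin (((Complex.log (-z)).im + Real.pi) / μ) := by
    rw [Complex.log_im]
    refine Real.sin_pos_of_pos_of_lt_pi (by positivity) ?_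
    rw [div_lt_iff₀ hμ0]
    linarith
  have hcont : ContinuousAt (fun t => Real.sin ((t + Real.pi) / μ)) (Complex.log (-z)).im := by
    fun_prop
  have hsinev := hcont.eventually (lt_mem_nhds hsin)
  have him : ContinuousAt (fun x : ℂ => (Complex.log (-x)).im) z :=
    Complex.continuous_im.continuousAt.comp (continuousAt_log_neg hslit)
  have hrpow : ∀ x : ℂ, -x ∈ Complex.slitPlane →
      0 < ‖x‖ ∧ ‖x‖ ^ a = Real.exp (a * (Complex.log (-x)).re) := by
    intro x hx
    have hx0 : 0 < ‖x‖ := by simpa using Complex.slitPlane_ne_zero hx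
    rw [Real.rpow_def_of_pos hx0, Complex.log_re, norm_neg, mul_comm]
    exact ⟨hx0, rfl⟩
  have hw_eq : w =ᶠ[nhds z] fun x =>
      (-(Real.log μ + (Complex.log (-x)).re) +
        Real.log (1 + A * Real.exp (a * (Complex.log (-x)).re))) +
      -Real.log (Real.sin (((Complex.log (-x)).im + Real.pi) / μ)) := by
    filter_upwards [eventually_neg_mem_slitPlane hslit, him.eventually hsinev] with x hx hsx
    obtain ⟨hx0, hxa⟩ := hrpow x hx
    rw [Complex.log_im] at hsx
    rw [hw, hxa, polarAngle_eq_arg_neg_add_pi hx, Real.log_mul (by positivity) hsx.ne',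
      Real.log_mul hμ0.ne' hx0.ne', Complex.log_im, Complex.log_re, norm_neg]
    ring
  have hlap := lap_comp_log_neg hslit hw_eq
    (Filter.Eventually.of_forall fun t => hasDerivAt_neg_add_log_one_add_exp hA a (Real.log μ) t)
    (hsinev.mono fun t ht => hasDerivAt_neg_log_sin_div ht.ne')
    (hasDerivAt_neg_one_add_logistic hA a _) (hasDerivAt_neg_cot_div hsin.ne')
  obtain ⟨hz0, hza⟩ := hrpow z hslit
  rw [hlap, ← hza, hw, polarAngle_eq_arg_neg_add_pi hslit]
  rw [Complex.log_im] at hsin ⊢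
  set s := Real.sin ((Complex.arg (-z) + Real.pi) / μ) with hs
  have hT : 0 < A * ‖z‖ ^ a := by positivity
  set T := A * ‖z‖ ^ a with hTdef
  have hexp : Real.exp (2 * (-Real.log (μ * ‖z‖ * s) + Real.log (1 + T))) =
      ((1 + T) / (μ * ‖z‖ * s)) ^ 2 := by
    rw [neg_add_eq_sub, ← Real.log_div (by positivity) (by positivity), mul_comm, Real.exp_mul,
      Real.exp_log (by positivity)]
    norm_cast
  have ha2 : a ^ 2 = 2 / μ ^ 2 := by
    rw [ha, div_pow, Real.sq_sqrt (by norm_num)]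
  rw [hexp, ha2]
  have key := liouville_algebraic_inequality hsin (Real.sin_le_one _) hT
  calc (2 / μ ^ 2 * T / (1 + T) ^ 2 + 1 / (μ ^ 2 * s ^ 2)) / ‖z‖ ^ 2
      = (2 * T / (1 + T) ^ 2 + 1 / s ^ 2) / (μ ^ 2 * ‖z‖ ^ 2) := by field_simp
    _ ≤ ((1 + T) ^ 2 / s ^ 2) / (μ ^ 2 * ‖z‖ ^ 2) := by gcongr
    _ = ((1 + T) / (μ * ‖z‖ * s)) ^ 2 := by field_simp
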